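/- arXiv:1710.02191 — 2 statements merged into one kernel-verified Lean document; each statement's English description precedes it below -/
import Mathlib

section
/- Suppose the sequence A = (A_n)_{n∈ℕ} is uniform exponentially bounded, i.e., there exist M > 0 and α ∈ ℝ with ‖A(m,n)‖ ≤ M e^{α(m−n)} for all m ≥ n. Then A is uniform exponentially stable (there exist N > 0 and ν < 0 with ‖A(m,n)‖ ≤ N e^{ν(m−n)} for all m ≥ n) if and only if the operator G = T − Id is invertible on c00 (bijective with bounded inverse). -/
open Filter Topology

variable {E : Type*} [NormedAddCommGroup E] [NormedSpace ℝ E] [CompleteSpace E]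

/-- `evol A n m` is the evolution operator `A(m,n) = A_{m-1} ∘ ⋯ ∘ A_n`
(the identity if `m ≤ n`). -/
def evol (A : ℕ → E →L[ℝ] E) (n : ℕ) : ℕ → E →L[ℝ] E
  | 0 => 1
  | m + 1 => if n ≤ m then A m * evol A n m else 1

/-- `α` is an admissible exponent for `A`: there is a positive sequence `M` with
`‖A(m,n)‖ ≤ M n * e^{α (m - n)}` for all `m ≥ n`. -/
def IsAdmissible (A : ℕ → E →L[ℝ] E) (α : ℝ) : Prop :=
  ∃ M : ℕ → ℝ, (∀ n, 0 < M n) ∧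
    ∀ m n : ℕ, n ≤ m → ‖evol A n m‖ ≤ M n * Real.exp (α * ((m : ℝ) - (n : ℝ)))

/-- The norm `‖x‖_{n,α} = sup_{m ≥ n} e^{-α(m-n)} ‖A(m,n) x‖`. -/
noncomputable def nnorm (A : ℕ → E →L[ℝ] E) (α : ℝ) (n : ℕ) (x : E) : ℝ :=
  ⨆ m : Set.Ici n, Real.exp (-α * (((m : ℕ) : ℝ) - (n : ℝ))) * ‖evol A n (m : ℕ) x‖

/-- Membership in `c00(α)`: `u 0 = 0` and `‖u n‖_{n,α} → 0`. -/
def MemC00 (A : ℕ → E →L[ℝ] E) (α : ℝ) (u : ℕ → E) : Prop :=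
  u 0 = 0 ∧ Tendsto (fun n => nnorm A α n (u n)) atTop (𝓝 0)

/-- The norm `‖u‖_α = sup_n ‖u n‖_{n,α}` on `c00(α)`. -/
noncomputable def cnorm (A : ℕ → E →L[ℝ] E) (α : ℝ) (u : ℕ → E) : ℝ :=
  ⨆ n, nnorm A α n (u n)

/-- The evolution map `T`: `(Tu)_0 = 0`, `(Tu)_{n+1} = A_n u_n`. -/
def Tmap (A : ℕ → E →L[ℝ] E) (u : ℕ → E) : ℕ → E
  | 0 => 0
  | m + 1 => A m (u m)

/-- `G = T - Id`. -/
def Gmap (A : ℕ → E →L[ℝ] E) (u : ℕ → E) : ℕ → E :=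
  fun n => Tmap A u n - u n

/-- Membership in `c00` (with the original norm of `E`). -/
def MemC00u (u : ℕ → E) : Prop :=
  u 0 = 0 ∧ Tendsto (fun n => ‖u n‖) atTop (𝓝 0)

/-- The sup norm `‖u‖_∞ = sup_n ‖u n‖`. -/
noncomputable def supNorm (u : ℕ → E) : ℝ := ⨆ n, ‖u n‖

/-- `G` is invertible on `c00`: it maps `c00` into itself, is bijective on `c00`,
and has a bounded inverse. -/
def GInvertibleU (A : ℕ → E →L[ℝ] E) : Prop :=
  (∀ u, MemC00u u → MemC00u (Gmap A u)) ∧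
  (∀ v, MemC00u v → ∃ u, MemC00u u ∧ Gmap A u = v) ∧
  (∀ u : ℕ → E, MemC00u u → Gmap A u = 0 → u = 0) ∧
  ∃ c > 0, ∀ u, MemC00u u → supNorm u ≤ c * supNorm (Gmap A u)

section

omit [CompleteSpace E]

theorem evol_self (A : ℕ → E →L[ℝ] E) (n : ℕ) : evol A n n = 1 := by
  cases n <;> simp [evol]

theorem evol_succ (A : ℕ → E →L[ℝ] E) {n m : ℕ} (h : n ≤ m) :
    evol A n (m + 1) = A m * evol A n m := by
  simp [evol, h]

theorem evol_mul_evol (A : ℕ → E →L[ℝ] E) {n k m : ℕ} (hnk : n ≤ k) (hkm : k ≤ m) :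
    evol A k m * evol A n k = evol A n m := by
  induction m, hkm using Nat.le_induction with
  | base => rw [evol_self, one_mul]
  | succ m hkm ih => rw [evol_succ A hkm, evol_succ A (hnk.trans hkm), mul_assoc, ih]

theorem Gmap_zero (A : ℕ → E →L[ℝ] E) (u : ℕ → E) : Gmap A u 0 = -u 0 := by
  simp [Gmap, Tmap]

theorem Gmap_succ (A : ℕ → E →L[ℝ] E) (u : ℕ → E) (n : ℕ) :
    Gmap A u (n + 1) = A n (u n) - u (n + 1) := rfl

theorem Gmap_injective (A : ℕ → E →L[ℝ] E) : Function.Injective (Gmap A) := by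
  intro u u' h
  funext n
  induction n with
  | zero => simpa [Gmap_zero] using congrFun h 0
  | succ n ih =>
    have := congrFun h (n + 1)
    rw [Gmap_succ, Gmap_succ, ih] at this
    exact sub_right_injective this

/-- Variation of constants: a preimage of `v` under `G = T - Id`. -/
theorem Gmap_neg_sum_evol (A : ℕ → E →L[ℝ] E) (v : ℕ → E) :
    Gmap A (fun n => -∑ k ∈ Finset.range (n + 1), evol A k n (v k)) = v := by
  funext n
  cases n with
  | zero => simp [Gmap_zero, evol_self]
  | succ n =>
    rw [Gmap_succ, Finset.sum_range_succ _ (n + 1), evol_self, map_neg, map_sum]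
    have : ∀ k ∈ Finset.range (n + 1), evol A k (n + 1) (v k) = A n (evol A k n (v k)) := by
      intro k hk
      rw [evol_succ A (by simpa [Nat.lt_succ_iff] using hk)]
      rfl
    rw [Finset.sum_congr rfl this]
    simp

omit [NormedSpace ℝ E] in
theorem MemC00u.norm_le_supNorm {u : ℕ → E} (hu : MemC00u u) (n : ℕ) : ‖u n‖ ≤ supNorm u :=
  le_ciSup hu.2.bddAbove_range n

omit [NormedSpace ℝ E] in
theorem supNorm_nonneg (u : ℕ → E) : 0 ≤ supNorm u :=
  Real.iSup_nonneg fun _ => norm_nonneg _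

/-- The convolution of a geometric sequence with a null sequence is a null sequence. -/
theorem tendsto_sum_geometric_mul {q : ℝ} (hq0 : 0 ≤ q) (hq1 : q < 1) {a : ℕ → ℝ}
    (ha : Tendsto a atTop (𝓝 0)) :
    Tendsto (fun n => ∑ k ∈ Finset.range (n + 1), q ^ (n - k) * a k) atTop (𝓝 0) := by
  obtain ⟨B, hB⟩ : ∃ B, ∀ n, ‖a n‖ ≤ B := by
    obtain ⟨B, hB⟩ := ha.norm.bddAbove_range
    exact ⟨B, fun n => hB ⟨n, rfl⟩⟩
  have hB0 : 0 ≤ B := (norm_nonneg _).trans (hB 0)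
  have key : Tendsto
      (fun n => ∑' j, if j ∈ Finset.range (n + 1) then q ^ j * a (n - j) else 0) atTop
      (𝓝 (∑' _ : ℕ, (0 : ℝ))) := by
    refine tendsto_tsum_of_dominated_convergence (bound := fun j => q ^ j * B)
      ((summable_geometric_of_lt_one hq0 hq1).mul_right B) ?_ ?_
    · intro j
      have h : Tendsto (fun n => q ^ j * a (n - j)) atTop (𝓝 0) := by
        simpa using (ha.comp (tendsto_sub_atTop_nat j)).const_mul (q ^ j)
      refine h.congr' ?_
      filter_upwards [eventually_ge_atTop j] with n hn
      rw [if_pos (Finset.mem_range.2 (Nat.lt_succ_of_le hn))]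
    · refine Eventually.of_forall fun n j => ?_
      split_ifs
      · rw [norm_mul, norm_pow, Real.norm_of_nonneg hq0]
        gcongr
        exact hB _
      · simpa using by positivity
  rw [tsum_zero] at key
  refine key.congr fun n => ?_
  rw [tsum_eq_sum (s := Finset.range (n + 1)) fun j hj => if_neg hj,
    ← Finset.sum_range_reflect (fun k => q ^ (n - k) * a k)]
  refine Finset.sum_congr rfl fun j hj => ?_
  have : j ≤ n := Nat.lt_succ_iff.1 (Finset.mem_range.1 hj)
  rw [if_pos hj, show n + 1 - 1 - j = n - j by omega, Nat.sub_sub_self this]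

theorem sum_geometric_le {q : ℝ} (hq0 : 0 ≤ q) (hq1 : q < 1) (n : ℕ) :
    ∑ k ∈ Finset.range (n + 1), q ^ (n - k) ≤ (1 - q)⁻¹ := by
  have := Finset.sum_range_reflect (fun k => q ^ k) (n + 1)
  simp only [Nat.add_sub_cancel] at this
  rw [this, ← tsum_geometric_of_lt_one hq0 hq1]
  exact (summable_geometric_of_lt_one hq0 hq1).sum_le_tsum _ fun _ _ => by positivity

theorem GInvertibleU_of_stable (A : ℕ → E →L[ℝ] E) {N q : ℝ} (hN : 0 < N) (hq0 : 0 ≤ q)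
    (hq1 : q < 1) (h : ∀ m n : ℕ, n ≤ m → ‖evol A n m‖ ≤ N * q ^ (m - n)) :
    GInvertibleU A := by
  have hsol : ∀ v : ℕ → E, ∀ n, ‖-∑ k ∈ Finset.range (n + 1), evol A k n (v k)‖ ≤
      N * ∑ k ∈ Finset.range (n + 1), q ^ (n - k) * ‖v k‖ := by
    intro v n
    rw [norm_neg, Finset.mul_sum]
    refine norm_sum_le_of_le _ fun k hk => ?_
    rw [← mul_assoc]
    exact (evol A k n).le_of_opNorm_le (h n k (by simpa [Nat.lt_succ_iff] using hk)) _
  have hmaps : ∀ u, MemC00u u → MemC00u (Gmap A u) := by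
    refine fun u hu => ⟨by simp [Gmap_zero, hu.1], ?_⟩
    rw [← tendsto_add_atTop_iff_nat 1]
    have hA : ∀ n, ‖A n‖ ≤ N * q := fun n => by
      simpa [evol_succ, evol_self] using h (n + 1) n n.le_succ
    refine squeeze_zero (fun _ => norm_nonneg _) (fun n => ?_)
      (g := fun n => N * q * ‖u n‖ + ‖u (n + 1)‖) ?_
    · rw [Gmap_succ]
      exact (norm_sub_le _ _).trans (add_le_add ((A n).le_of_opNorm_le (hA n) _) le_rfl)
    · simpa using (hu.2.const_mul (N * q)).add (hu.2.comp (tendsto_add_atTop_nat 1))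
  refine ⟨hmaps, fun v hv => ⟨_, ⟨?_, ?_⟩, Gmap_neg_sum_evol A v⟩, fun u _ hu0 => ?_,
    N * (1 - q)⁻¹, ?_, fun u hu => ?_⟩
  · simp [hv.1]
  · refine squeeze_zero (fun _ => norm_nonneg _) (hsol v) ?_
    simpa using (tendsto_sum_geometric_mul hq0 hq1 hv.2).const_mul N
  · refine Gmap_injective A (hu0.trans ?_)
    funext n
    cases n <;> simp [Gmap, Tmap]
  · have : 0 < 1 - q := sub_pos.2 hq1
    positivity
  · have hv : MemC00u (Gmap A u) := hmaps u hu
    have hu' := Gmap_injective A (Gmap_neg_sum_evol A (Gmap A u))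
    refine ciSup_le fun n => ?_
    rw [← congrFun hu' n]
    refine (hsol _ n).trans ?_
    rw [mul_assoc]
    gcongr
    calc _ ≤ ∑ k ∈ Finset.range (n + 1), q ^ (n - k) * supNorm (Gmap A u) := by
          gcongr with k
          exact hv.norm_le_supNorm k
      _ ≤ _ := by
          rw [← Finset.sum_mul]
          exact mul_le_mul_of_nonneg_right (sum_geometric_le hq0 hq1 n) (supNorm_nonneg _)

theorem Gmap_sum_smul_evol (A : ℕ → E →L[ℝ] E) {n : ℕ} (hn : 1 ≤ n) (x : E) (w : ℕ → ℝ) :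
    Gmap A (fun k => (∑ j ∈ Finset.Ico n (k + 1), w j) • evol A n k x) =
      fun k => if n ≤ k then -(w k • evol A n k x) else 0 := by
  funext k
  cases k with
  | zero => rw [Gmap_zero, Finset.Ico_eq_empty (by omega), if_neg (by omega)]; simp
  | succ k =>
    rw [Gmap_succ]
    rcases lt_trichotomy n (k + 1) with h | h | h
    · rw [if_pos h.le, Finset.sum_Ico_succ_top h.le, evol_succ A (Nat.lt_succ_iff.1 h),
        map_smul, add_smul]
      simp
    · subst h
      simp
    · rw [Finset.Ico_eq_empty (by omega), Finset.Ico_eq_empty (by omega), if_neg (by omega)]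
      simp

/-- Testing invertibility of `G` on weighted, finitely supported pieces of an orbit. -/
theorem norm_sum_smul_evol_le {A : ℕ → E →L[ℝ] E} {c : ℝ} (hc : 0 < c)
    (hsurj : ∀ v, MemC00u v → ∃ u, MemC00u u ∧ Gmap A u = v)
    (hbd : ∀ u, MemC00u u → supNorm u ≤ c * supNorm (Gmap A u))
    {n : ℕ} (hn : 1 ≤ n) (x : E) {w : ℕ → ℝ} {m : ℕ} (hw : ∀ k, m < k → w k = 0)
    {B : ℝ} (hB0 : 0 ≤ B) (hB : ∀ k, n ≤ k → ‖w k • evol A n k x‖ ≤ B) (k : ℕ) :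
    ‖(∑ j ∈ Finset.Ico n (k + 1), w j) • evol A n k x‖ ≤ c * B := by
  have hG := Gmap_sum_smul_evol A hn x w
  obtain ⟨u, hu, huv⟩ := hsurj (fun k => if n ≤ k then -(w k • evol A n k x) else 0) <| by
    refine ⟨if_neg (by omega), tendsto_const_nhds.congr' ?_⟩
    filter_upwards [eventually_gt_atTop m] with k hk
    simp [hw k hk]
  rw [← hG] at huv
  obtain rfl := Gmap_injective A huv
  refine (hu.norm_le_supNorm k).trans ((hbd _ hu).trans ?_)
  gcongr
  refine ciSup_le fun k => ?_
  rw [hG]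
  dsimp only
  split_ifs with h
  · rw [norm_neg]
    exact hB k h
  · simpa

theorem stable_of_GInvertibleU (A : ℕ → E →L[ℝ] E) (h : GInvertibleU A) :
    ∃ N : ℝ, 0 < N ∧ ∃ ν : ℝ, ν < 0 ∧
      ∀ m n : ℕ, n ≤ m → ‖evol A n m‖ ≤ N * Real.exp (ν * ((m : ℝ) - (n : ℝ))) := by
  obtain ⟨-, hsurj, -, c, hc, hbd⟩ := h
  have bounded : ∀ n m, 1 ≤ n → n ≤ m → ‖evol A n m‖ ≤ c := by
    intro n m hn hm
    refine ContinuousLinearMap.opNorm_le_bound _ hc.le fun x => ?_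
    have := norm_sum_smul_evol_le hc hsurj hbd hn x (w := fun j => if j = n then 1 else 0)
      (m := n) (fun k hk => if_neg hk.ne') (norm_nonneg x) (fun k _ => ?_) m
    · simpa [Nat.lt_succ_iff, hm] using this
    · split_ifs with hk
      · simp [hk, evol_self]
      · simp
  have decay : ∀ n d : ℕ, 1 ≤ n → ((d : ℝ) + 1) * ‖evol A n (n + d)‖ ≤ c * c := by
    intro n d hn
    rw [← le_div_iff₀' (by positivity)]
    refine ContinuousLinearMap.opNorm_le_bound _ (by positivity) fun x => ?_
    have := norm_sum_smul_evol_le hc hsurj hbd hn x (w := fun j => if j ≤ n + d then 1 else 0)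
      (m := n + d) (fun k hk => if_neg hk.not_ge) (B := c * ‖x‖) (by positivity)
      (fun k hk => ?_) (n + d)
    · rw [Finset.sum_congr rfl (g := fun _ => (1 : ℝ)) fun j hj =>
        if_pos (Nat.lt_succ_iff.1 (Finset.mem_Ico.1 hj).2)] at this
      rw [Finset.sum_const, Nat.card_Ico, show n + d + 1 - n = d + 1 by omega, nsmul_one,
        norm_smul, Real.norm_of_nonneg (by positivity)] at this
      push_cast at this
      rw [div_mul_eq_mul_div, le_div_iff₀' (by positivity)]
      linarith
    · have := (evol A n k).le_of_opNorm_le (bounded n k hn hk) x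
      split_ifs
      · simpa using this
      · simpa using by positivity
  obtain ⟨K, hK⟩ := exists_nat_gt (2 * (c * c))
  have hK0 : (0 : ℝ) < K := lt_trans (by positivity) hK
  have half : ∀ n, 1 ≤ n → ‖evol A n (n + K)‖ ≤ 1 / 2 := by
    intro n hn
    have := decay n K hn
    by_contra! hlt
    nlinarith
  have hlog : 0 < Real.log 2 := Real.log_pos (by norm_num)
  set ν : ℝ := -(Real.log 2 / K) with hν
  have hν0 : ν < 0 := by rw [hν, neg_lt_zero]; positivity
  have hνK : Real.exp (ν * K) = 1 / 2 := by
    rw [hν, neg_mul, div_mul_cancel₀ _ hK0.ne', Real.exp_neg, Real.exp_log (by norm_num)]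
    norm_num
  have main : ∀ d n, 1 ≤ n → ‖evol A n (n + d)‖ ≤ 2 * c * Real.exp (ν * d) := by
    intro d
    induction d using Nat.strong_induction_on with
    | _ d ih =>
      intro n hn
      rcases lt_or_ge d K with hd | hd
      · refine (bounded n _ hn (by omega)).trans ?_
        have : Real.exp (ν * K) ≤ Real.exp (ν * d) :=
          Real.exp_le_exp.2 (mul_le_mul_of_nonpos_left (by exact_mod_cast hd.le) hν0.le)
        nlinarith
      · obtain ⟨e, rfl⟩ := Nat.exists_eq_add_of_le hd
        have hKpos : 0 < K := by exact_mod_cast hK0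
        rw [← evol_mul_evol A (show n ≤ n + K by omega) (show n + K ≤ n + (K + e) by omega)]
        calc _ ≤ ‖evol A (n + K) (n + (K + e))‖ * ‖evol A n (n + K)‖ := norm_mul_le _ _
          _ ≤ (2 * c * Real.exp (ν * e)) * (1 / 2) := by
            gcongr
            · rw [← add_assoc]
              exact ih e (by omega) (n + K) (by omega)
            · exact half n hn
          _ = _ := by
            rw [← hνK]
            push_cast
            rw [mul_add, Real.exp_add]
            ring
  refine ⟨1 + 2 * c + 2 * c * Real.exp (-ν) * ‖A 0‖, by positivity, ν, hν0, fun m n hmn => ?_⟩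
  obtain ⟨d, rfl⟩ := Nat.exists_eq_add_of_le hmn
  rw [Nat.cast_add, add_sub_cancel_left]
  have hpos : 0 ≤ 2 * c * Real.exp (-ν) * ‖A 0‖ := by positivity
  rcases Nat.eq_zero_or_pos n with rfl | hn
  · cases d with
    | zero =>
      have : ‖evol A 0 (0 + 0)‖ ≤ 1 := ContinuousLinearMap.norm_id_le
      simp only [Nat.cast_zero, mul_zero, Real.exp_zero, mul_one]
      linarith
    | succ d =>
      rw [← evol_mul_evol A (show 0 ≤ 1 by omega) (show 1 ≤ 0 + (d + 1) by omega)]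
      have h1 : evol A 0 1 = A 0 := by simp [evol]
      calc _ ≤ ‖evol A 1 (0 + (d + 1))‖ * ‖evol A 0 1‖ := norm_mul_le _ _
        _ ≤ 2 * c * Real.exp (ν * d) * ‖A 0‖ := by
          rw [h1, show 0 + (d + 1) = 1 + d by omega]
          gcongr
          exact main d 1 le_rfl
        _ = 2 * c * Real.exp (-ν) * ‖A 0‖ * Real.exp (ν * (d + 1 : ℕ)) := by
          have : Real.exp (ν * d) = Real.exp (-ν) * Real.exp (ν * (d + 1 : ℕ)) := by
            rw [← Real.exp_add]
            push_cast
            ring_nf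
          rw [this]
          ring
        _ ≤ _ := by
          gcongr
          linarith
  · refine (main d n hn).trans ?_
    gcongr
    linarith

end

/-- A uniform exponentially bounded sequence `A` is uniform
exponentially stable iff the operator `G = T - Id` is invertible on `c00`. -/
theorem stmt14 (A : ℕ → E →L[ℝ] E) (M α : ℝ) (hM : 0 < M)
    (hbd : ∀ m n : ℕ, n ≤ m → ‖evol A n m‖ ≤ M * Real.exp (α * ((m : ℝ) - (n : ℝ)))) :
    (∃ N : ℝ, 0 < N ∧ ∃ ν : ℝ, ν < 0 ∧
        ∀ m n : ℕ, n ≤ m → ‖evol A n m‖ ≤ N * Real.exp (ν * ((m : ℝ) - (n : ℝ)))) ↔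
      GInvertibleU A := by
  refine ⟨fun ⟨N, hN, ν, hν, h⟩ => ?_, stable_of_GInvertibleU A⟩
  refine GInvertibleU_of_stable A hN (Real.exp_pos ν).le (Real.exp_lt_one_iff.2 hν) fun m n hmn => ?_
  refine (h m n hmn).trans_eq ?_
  rw [← Real.exp_nat_mul, Nat.cast_sub hmn, mul_comm ν]
end

section
/- Let E be a Banach space, a_n = n/(2 + (−1)^n) for n ∈ ℕ, and A_n = e^{a_n − a_{n+1}} Id, so that A(m,n) = e^{a_n − a_m} Id for m ≥ n. Then: the set of admissible exponents of A = (A_n) is exactly [−1/3, ∞); A is not uniform exponentially bounded (for no α ∈ ℝ does there exist a constant M > 0 with ‖A(m,n)‖ ≤ M e^{α(m−n)} for all m ≥ n); A is nonuniform exponentially stable; and c00(α) = c00(−1/3) for every admissible exponent α of A. -/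
open Filter Topology

variable {E : Type*} [NormedAddCommGroup E] [NormedSpace ℝ E] [CompleteSpace E]

/-- The sequence `a_n = n / (2 + (-1)^n)` of Example 5.1. -/
noncomputable def exSeqA : ℕ → ℝ := fun n => (n : ℝ) / (2 + (-1 : ℝ) ^ n)

/-- The operators `A_n = e^{a_n - a_{n+1}} Id` of Example 5.1. -/
noncomputable def exOpA : ℕ → E →L[ℝ] E :=
  fun n => Real.exp (exSeqA n - exSeqA (n + 1)) • (1 : E →L[ℝ] E)

theorem exSeqA_of_even {n : ℕ} (hn : Even n) : exSeqA n = n / 3 := by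
  simp only [exSeqA, hn.neg_one_pow]
  norm_num

theorem exSeqA_of_odd {n : ℕ} (hn : Odd n) : exSeqA n = n := by
  simp only [exSeqA, hn.neg_one_pow]
  norm_num

theorem div_three_le_exSeqA (n : ℕ) : (n : ℝ) / 3 ≤ exSeqA n := by
  have h0 : (0 : ℝ) ≤ n := n.cast_nonneg
  rcases n.even_or_odd with hn | hn
  · rw [exSeqA_of_even hn]
  · rw [exSeqA_of_odd hn]
    linarith

theorem evol_exOpA {n m : ℕ} (h : n ≤ m) :
    evol (exOpA (E := E)) n m = Real.exp (exSeqA n - exSeqA m) • (1 : E →L[ℝ] E) := by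
  induction m, h using Nat.le_induction with
  | base => cases n <;> simp [evol]
  | succ m h ih =>
    rw [evol, if_pos h, ih, exOpA, smul_mul_smul_comm, ← Real.exp_add, mul_one]
    congr 2
    ring

theorem norm_evol_exOpA_apply {n m : ℕ} (h : n ≤ m) (x : E) :
    ‖evol (exOpA (E := E)) n m x‖ = Real.exp (exSeqA n - exSeqA m) * ‖x‖ := by
  rw [evol_exOpA h, smul_apply, one_apply_eq_self, norm_smul, Real.norm_eq_abs,
    Real.abs_exp]

theorem norm_evol_exOpA [Nontrivial E] {n m : ℕ} (h : n ≤ m) :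
    ‖evol (exOpA (E := E)) n m‖ = Real.exp (exSeqA n - exSeqA m) := by
  rw [evol_exOpA h, norm_smul, Real.norm_eq_abs, Real.abs_exp, norm_one, mul_one]

theorem isAdmissible_exOpA_iff [Nontrivial E] (α : ℝ) :
    IsAdmissible (exOpA (E := E)) α ↔ -(1 / 3 : ℝ) ≤ α := by
  constructor
  · rintro ⟨M, hM, h⟩
    by_contra! hα
    obtain ⟨k, hk⟩ := exists_nat_gt (Real.log (M 0) / (-(1 / 3) - α))
    rw [div_lt_iff₀ (by linarith)] at hk
    have hk0 := h (2 * k) 0 (Nat.zero_le _)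
    rw [norm_evol_exOpA (Nat.zero_le _), exSeqA_of_even (even_two_mul k),
      exSeqA_of_even Even.zero, ← Real.exp_log (hM 0), ← Real.exp_add, Real.exp_le_exp] at hk0
    push_cast at hk0
    have : (0 : ℝ) ≤ k * (-(1 / 3) - α) := mul_nonneg k.cast_nonneg (by linarith)
    linarith
  · intro hα
    refine ⟨fun n => Real.exp (exSeqA n - n / 3), fun n => Real.exp_pos _, fun m n h => ?_⟩
    rw [norm_evol_exOpA h, ← Real.exp_add, Real.exp_le_exp]
    have hmn : (n : ℝ) ≤ m := by exact_mod_cast h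
    have := div_three_le_exSeqA m
    nlinarith [mul_nonneg (sub_nonneg.2 hα) (sub_nonneg.2 hmn)]

theorem not_uniform_exponentially_bounded_exOpA [Nontrivial E] :
    ¬ ∃ α : ℝ, ∃ M : ℝ, 0 < M ∧
      ∀ m n : ℕ, n ≤ m →
        ‖evol (exOpA (E := E)) n m‖ ≤ M * Real.exp (α * ((m : ℝ) - (n : ℝ))) := by
  rintro ⟨α, M, hM, h⟩
  obtain ⟨k, hk⟩ := exists_nat_gt (Real.log M + α)
  have hle : 2 * k + 1 ≤ 2 * k + 1 + 1 := Nat.le_succ _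
  have hk1 := h _ _ hle
  rw [norm_evol_exOpA hle, exSeqA_of_odd (odd_two_mul_add_one k),
    exSeqA_of_even (odd_two_mul_add_one k).add_one, ← Real.exp_log hM, ← Real.exp_add,
    Real.exp_le_exp] at hk1
  push_cast at hk1
  have : (0 : ℝ) ≤ k := k.cast_nonneg
  linarith

theorem exp_mul_norm_evol_exOpA_le {α : ℝ} (hα : -(1 / 3 : ℝ) ≤ α) {n m : ℕ} (h : n ≤ m) (x : E) :
    Real.exp (-α * ((m : ℝ) - (n : ℝ))) * ‖evol (exOpA (E := E)) n m x‖ ≤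
      Real.exp (exSeqA n - n / 3) * ‖x‖ := by
  rw [norm_evol_exOpA_apply h, ← mul_assoc, ← Real.exp_add]
  gcongr
  have hmn : (n : ℝ) ≤ m := by exact_mod_cast h
  have := div_three_le_exSeqA m
  nlinarith [mul_nonneg (sub_nonneg.2 hα) (sub_nonneg.2 hmn)]

theorem nnorm_exOpA_le {α : ℝ} (hα : -(1 / 3 : ℝ) ≤ α) (n : ℕ) (x : E) :
    nnorm (exOpA (E := E)) α n x ≤ Real.exp (exSeqA n - n / 3) * ‖x‖ :=
  ciSup_le fun m => exp_mul_norm_evol_exOpA_le hα m.2 x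

theorem le_nnorm_exOpA {α : ℝ} (hα : -(1 / 3 : ℝ) ≤ α) (n : ℕ) (x : E) :
    Real.exp (-(α + 1 / 3)) * (Real.exp (exSeqA n - n / 3) * ‖x‖) ≤
      nnorm (exOpA (E := E)) α n x := by
  obtain ⟨m, hnm, hmn, hm⟩ : ∃ m, n ≤ m ∧ m ≤ n + 1 ∧ Even m := by
    rcases n.even_or_odd with hn | hn
    · exact ⟨n, le_rfl, n.le_succ, hn⟩
    · exact ⟨n + 1, n.le_succ, le_rfl, hn.add_one⟩
  have hbdd : BddAbove (Set.range fun m : Set.Ici n =>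
      Real.exp (-α * (((m : ℕ) : ℝ) - (n : ℝ))) * ‖evol (exOpA (E := E)) n (m : ℕ) x‖) :=
    ⟨_, Set.forall_mem_range.2 fun m => exp_mul_norm_evol_exOpA_le hα m.2 x⟩
  refine le_trans ?_ (le_ciSup hbdd ⟨m, hnm⟩)
  rw [norm_evol_exOpA_apply hnm, ← mul_assoc, ← mul_assoc, ← Real.exp_add, ← Real.exp_add,
    exSeqA_of_even hm]
  refine mul_le_mul_of_nonneg_right (Real.exp_le_exp.2 ?_) (norm_nonneg x)
  have hmn' : (m : ℝ) ≤ n + 1 := by exact_mod_cast hmn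
  nlinarith [mul_nonneg (sub_nonneg.2 hα) (sub_nonneg.2 hmn')]

theorem memC00_exOpA_iff {α : ℝ} (hα : -(1 / 3 : ℝ) ≤ α) (u : ℕ → E) :
    MemC00 (exOpA (E := E)) α u ↔
      u 0 = 0 ∧ Tendsto (fun n => Real.exp (exSeqA n - n / 3) * ‖u n‖) atTop (𝓝 0) := by
  refine and_congr_right fun _ => ⟨fun h => ?_, fun h => ?_⟩
  · refine squeeze_zero (fun n => by positivity) (fun n => ?_)
      (by simpa only [mul_zero] using h.const_mul (Real.exp (α + 1 / 3)))
    have := mul_le_mul_of_nonneg_left (le_nnorm_exOpA hα n (u n)) (Real.exp_pos (α + 1 / 3)).le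
    rwa [← mul_assoc, ← Real.exp_add, add_neg_cancel, Real.exp_zero, one_mul] at this
  · exact squeeze_zero (fun n => le_trans (by positivity) (le_nnorm_exOpA hα n (u n)))
      (fun n => nnorm_exOpA_le hα n (u n)) h

/-- For `A_n = e^{a_n - a_{n+1}} Id` with `a_n = n/(2 + (-1)^n)`:
the admissible exponents of `A` are exactly `[-1/3, ∞)`; `A` is not uniform
exponentially bounded; `A` is nonuniform exponentially stable; and
`c00(α) = c00(-1/3)` for every admissible exponent `α`. -/
theorem stmt17 [Nontrivial E] :
    (∀ α : ℝ, IsAdmissible (exOpA (E := E)) α ↔ -(1 / 3 : ℝ) ≤ α) ∧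
    (¬ ∃ α : ℝ, ∃ M : ℝ, 0 < M ∧
        ∀ m n : ℕ, n ≤ m →
          ‖evol (exOpA (E := E)) n m‖ ≤ M * Real.exp (α * ((m : ℝ) - (n : ℝ)))) ∧
    (∃ ν : ℝ, ν < 0 ∧ IsAdmissible (exOpA (E := E)) ν) ∧
    (∀ α : ℝ, IsAdmissible (exOpA (E := E)) α →
      ∀ u : ℕ → E, MemC00 (exOpA (E := E)) α u ↔
        MemC00 (exOpA (E := E)) (-(1 / 3 : ℝ)) u) := by
  refine ⟨isAdmissible_exOpA_iff, not_uniform_exponentially_bounded_exOpA,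
    ⟨-(1 / 3), by norm_num, (isAdmissible_exOpA_iff _).2 le_rfl⟩, fun α hα u => ?_⟩
  rw [memC00_exOpA_iff ((isAdmissible_exOpA_iff α).1 hα), memC00_exOpA_iff le_rfl]
end
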